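/- arXiv:2508.13289 — 2 statements merged into one kernel-verified Lean document; each statement's English description precedes it below -/
import Mathlib

section
/- Let X be an n-correct set, μ a maximal curve for X of degree k ≤ n, B := X \ μ, A := X ∩ μ. Suppose {A_i, B, C_i}, 1 ≤ i ≤ m, are distinct special triplets of X with a common node B, where m ≥ 2, A_i ∈ A, B ∈ B, C_i ∈ X. Then: (1) each line ℓ_i := ℓ_{A_iC_i} is a component of μ, these m components are distinct (hence m ≤ k), B ∉ ℓ_i, and {A_j, C_j} ∩ ℓ_i = ∅ for all j ≠ i; (2) setting μ_{k−i} := μ/(ℓ₁⋯ℓ_i), each μ_{k−i} is a maximal curve for X of degree k−i; (3) each set B_{n−k+i} := X \ μ_{k−i} is (n−k+i)-correct, and each set ℓ̇_i := {M ∈ ℓ_i ∩ X : μ_{k−i}(M) ≠ 0} consists of A_i, C_i, together with the n−k zeros of p*_{B,B} on ℓ_i (all real and distinct) and the i−1 intersection points D_{ij} = ℓ_i ∩ ℓ_j for 1 ≤ j ≤ i−1; (4) each ℓ_i is a maximal line of B_{n−k+s} for every i ≤ s ≤ m; in particular all the lines ℓ₁,…,ℓ_m are maximal lines of B_{n−k+m}.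 -/
open MvPolynomial Finset
open scoped Classical BigOperators

noncomputable section

/-- Points of the plane. -/
abbrev Pt : Type := Fin 2 → ℝ

/-- Bivariate real polynomials. -/
abbrev Poly2 : Type := MvPolynomial (Fin 2) ℝ

/-- `N = dim Π_n = (n+1)(n+2)/2`. -/
def Nn (n : ℕ) : ℕ := (n + 1) * (n + 2) / 2

/-- `X` is an `n`-correct set of nodes: it has `N` nodes and the only polynomial of total
degree at most `n` vanishing at all of them is the zero polynomial. -/
def IsNCorrect (n : ℕ) (X : Finset Pt) : Prop :=
  X.card = Nn n ∧
  ∀ p : Poly2, p.totalDegree ≤ n → (∀ P ∈ X, eval P p = 0) → p = 0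

/-- A line: a (nonzero) polynomial of total degree exactly 1. -/
def IsLine (ℓ : Poly2) : Prop := ℓ.totalDegree = 1

/-- The zero set of a polynomial, as a subset of the plane. -/
def zeroSet (q : Poly2) : Set Pt := {P : Pt | eval P q = 0}

/-- `X ∩ q` : the nodes of `X` lying on the curve `q`. -/
def zerosIn (X : Finset Pt) (q : Poly2) : Finset Pt := X.filter fun P => eval P q = 0

/-- `X \ q` : the nodes of `X` not lying on the curve `q`. -/
def nonzerosIn (X : Finset Pt) (q : Poly2) : Finset Pt := X.filter fun P => eval P q ≠ 0

/-- `ℓ` is a maximal line for (an `n`-correct set) `X`: a line passing through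
exactly `n+1` nodes. -/
def IsMaximalLine (n : ℕ) (X : Finset Pt) (ℓ : Poly2) : Prop :=
  IsLine ℓ ∧ (zerosIn X ℓ).card = n + 1

/-- The collection of maximal lines of `X` (as subsets of the plane). -/
def maximalLines (n : ℕ) (X : Finset Pt) : Set (Set Pt) :=
  {Z : Set Pt | ∃ ℓ : Poly2, IsMaximalLine n X ℓ ∧ Z = zeroSet ℓ}

/-- `p` is the `n`-fundamental polynomial of the node `A` of `X`. -/
def IsFund (n : ℕ) (X : Finset Pt) (A : Pt) (p : Poly2) : Prop :=
  p.totalDegree ≤ n ∧ eval A p = 1 ∧ ∀ P ∈ X, P ≠ A → eval P p = 0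

/-- The node `A` of `X` uses the curve `q`: `q` divides the fundamental polynomial of `A`. -/
def Uses (n : ℕ) (X : Finset Pt) (A : Pt) (q : Poly2) : Prop :=
  ∃ p : Poly2, IsFund n X A p ∧ q ∣ p

/-- `d(n,k) = k(2n+3-k)/2`. -/
def d (n k : ℕ) : ℕ := k * (2 * n + 3 - k) / 2

/-- `q` is a maximal curve of degree `k` for `X`: it passes through exactly `d(n,k)` nodes. -/
def IsMaximalCurve (n k : ℕ) (X : Finset Pt) (q : Poly2) : Prop :=
  q.totalDegree = k ∧ (zerosIn X q).card = d n k

/-- `{A,B,C}` is a special triplet of the `n`-correct set `X` : there is a maximal curve `f`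
of degree `n-1` with `X \ f = {A,B,C}`. -/
def IsSpecialTriplet (n : ℕ) (X : Finset Pt) (A B C : Pt) : Prop :=
  A ∈ X ∧ B ∈ X ∧ C ∈ X ∧ A ≠ B ∧ A ≠ C ∧ B ≠ C ∧
  ∃ f : Poly2, IsMaximalCurve n (n - 1) X f ∧ nonzerosIn X f = {A, B, C}

/-- `X` is a `GC_n` set: an `n`-correct set in which every fundamental polynomial is a
product of `n` linear factors. -/
def IsGC (n : ℕ) (X : Finset Pt) : Prop :=
  IsNCorrect n X ∧
  ∀ A ∈ X, ∃ p : Poly2, IsFund n X A p ∧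
    ∃ g : Fin n → Poly2, (∀ i, (g i).totalDegree = 1) ∧ p = ∏ i, g i

/-- `ℓ` is a line passing through the points `P` and `Q` (in particular, `ℓ_{PQ}` when
`P ≠ Q`). -/
def IsLineThrough (ℓ : Poly2) (P Q : Pt) : Prop :=
  IsLine ℓ ∧ eval P ℓ = 0 ∧ eval Q ℓ = 0

/-- `ℓ` is a `2`-node line of `X` passing through exactly the two nodes `A` and `B`. -/
def IsTwoNodeLineOf (X : Finset Pt) (ℓ : Poly2) (A B : Pt) : Prop :=
  IsLine ℓ ∧ A ≠ B ∧ zerosIn X ℓ = {A, B}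

/-- `Y` is an `n`-independent set: every point has an `n`-fundamental polynomial. -/
def IsNIndependent (n : ℕ) (Y : Finset Pt) : Prop :=
  ∀ A ∈ Y, ∃ p : Poly2, p.totalDegree ≤ n ∧ eval A p ≠ 0 ∧
    ∀ P ∈ Y, P ≠ A → eval P p = 0

/-- A family of lines is in general position: no two parallel (or equal) — i.e. any two of
them meet in a unique point — and no three concurrent. -/
def GenPos {m : ℕ} (ℓ : Fin m → Poly2) : Prop :=
  (∀ i, IsLine (ℓ i)) ∧
  (∀ i j, i ≠ j → ∃! P : Pt, eval P (ℓ i) = 0 ∧ eval P (ℓ j) = 0) ∧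
  (∀ i j k, i ≠ j → i ≠ k → j ≠ k →
    ¬∃ P : Pt, eval P (ℓ i) = 0 ∧ eval P (ℓ j) = 0 ∧ eval P (ℓ k) = 0)

/-- `X` is a Chung–Yao set of degree `n`: the set of pairwise intersection points of `n+2`
lines in general position. -/
def IsChungYao (n : ℕ) (X : Finset Pt) : Prop :=
  ∃ ℓ : Fin (n + 2) → Poly2, GenPos ℓ ∧
    (↑X : Set Pt) = {P : Pt | ∃ i j, i ≠ j ∧ eval P (ℓ i) = 0 ∧ eval P (ℓ j) = 0}

/-- `X` is a Carnicer–Gasca set of degree `n`: the pairwise intersection points of `n+1`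
lines in general position together with one extra point `A i` on each line `ℓ i`, the `A i`
lying on no other line of the family and not all collinear. -/
def IsCarnicerGasca (n : ℕ) (X : Finset Pt) : Prop :=
  ∃ (ℓ : Fin (n + 1) → Poly2) (A : Fin (n + 1) → Pt), GenPos ℓ ∧
    (∀ i j, eval (A i) (ℓ j) = 0 ↔ j = i) ∧
    (¬∃ L : Poly2, IsLine L ∧ ∀ i, eval (A i) L = 0) ∧
    (↑X : Set Pt) =
      {P : Pt | ∃ i j, i ≠ j ∧ eval P (ℓ i) = 0 ∧ eval P (ℓ j) = 0} ∪ Set.range A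

theorem two_mul_Nn (n : ℕ) : 2 * Nn n = (n + 1) * (n + 2) :=
  Nat.mul_div_cancel' (Nat.even_mul_succ_self (n + 1)).two_dvd

theorem Nn_succ (n : ℕ) : Nn (n + 1) = Nn n + (n + 2) := by
  have h₁ := two_mul_Nn n
  have h₂ := two_mul_Nn (n + 1)
  nlinarith

theorem d_add_Nn_sub {n k : ℕ} (hk : k ≤ n) : d n k + Nn (n - k) = Nn n := by
  obtain ⟨a, rfl⟩ := Nat.exists_eq_add_of_le hk
  have hd : 2 * d (k + a) k = k * (2 * (k + a) + 3 - k) := by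
    refine Nat.mul_div_cancel' ?_
    have h : 2 * (k + a) + 3 - k = (k + 1) + 2 * (a + 1) := by omega
    rw [h, mul_add]
    exact dvd_add (Nat.even_mul_succ_self k).two_dvd
      (Dvd.dvd.mul_left (dvd_mul_right 2 (a + 1)) k)
  have h : 2 * (k + a) + 3 - k = k + 2 * a + 3 := by omega
  rw [h] at hd
  have h₁ := two_mul_Nn a
  have h₂ := two_mul_Nn (k + a)
  rw [Nat.add_sub_cancel_left]
  nlinarith

/-- The exponent of the monomial `x ^ a * y ^ b`. -/
def expPair (q : ℕ × ℕ) : Fin 2 →₀ ℕ := Finsupp.single 0 q.1 + Finsupp.single 1 q.2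

theorem expPair_injective : Function.Injective expPair := by
  rintro ⟨a, b⟩ ⟨a', b'⟩ h
  have h₀ := DFunLike.congr_fun h 0
  have h₁ := DFunLike.congr_fun h 1
  simp [expPair] at h₀ h₁
  simp [h₀, h₁]

/-- The pairs of exponents of the monomials of total degree at most `n`. -/
def expPairs (n : ℕ) : Finset (ℕ × ℕ) :=
  (Finset.range (n + 1)).biUnion fun i => Finset.HasAntidiagonal.antidiagonal i

theorem card_expPairs (n : ℕ) : (expPairs n).card = Nn n := by
  rw [expPairs, Finset.card_biUnion]
  · induction n with
    | zero => simp [Nn]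
    | succ n ih => rw [Finset.sum_range_succ, ih, Nn_succ]; simp
  · intro i _ j _ hij
    rw [Function.onFun, Finset.disjoint_left]
    intro q hi hj
    exact hij ((HasAntidiagonal.mem_antidiagonal.1 hi).symm.trans (HasAntidiagonal.mem_antidiagonal.1 hj))

/-- Fewer than `dim Π_n` points always lie on a curve of degree at most `n`. -/
theorem exists_ne_zero_eval_eq_zero (n : ℕ) (S : Finset Pt) (hS : S.card < Nn n) :
    ∃ p : Poly2, p ≠ 0 ∧ p.totalDegree ≤ n ∧ ∀ P ∈ S, eval P p = 0 := by
  let Φ : (expPairs n → ℝ) →ₗ[ℝ] Poly2 :=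
    ∑ q : expPairs n, (monomial (expPair q.1)).comp (LinearMap.proj q)
  have hΦ : ∀ c, Φ c = ∑ q : expPairs n, monomial (expPair q.1) (c q) := fun c => by
    simp [Φ]
  let Ψ : (expPairs n → ℝ) →ₗ[ℝ] (S → ℝ) :=
    LinearMap.pi fun P => (MvPolynomial.aeval (R := ℝ) P.1).toLinearMap.comp Φ
  have hker : LinearMap.ker Ψ ≠ ⊥ := by
    apply LinearMap.ker_ne_bot_of_finrank_lt
    simpa [card_expPairs] using hS
  obtain ⟨c, hc, hc0⟩ := (Submodule.ne_bot_iff _).1 hker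
  refine ⟨Φ c, ?_, ?_, ?_⟩
  · intro h
    apply hc0
    funext q
    have := congrArg (MvPolynomial.coeff (expPair q.1)) h
    rw [hΦ, MvPolynomial.coeff_sum] at this
    simpa [MvPolynomial.coeff_monomial, expPair_injective.eq_iff, Subtype.val_inj] using this
  · rw [hΦ]
    apply totalDegree_finsetSum_le
    rintro ⟨q, hq⟩ -
    refine (totalDegree_monomial_le _ _).trans ?_
    obtain ⟨i, hi, hqi⟩ := Finset.mem_biUnion.1 hq
    rw [HasAntidiagonal.mem_antidiagonal] at hqi
    rw [Finset.mem_range] at hi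
    rw [Finsupp.sum_fintype _ _ (by simp)]
    simp [expPair]
    omega
  · intro P hP
    have := congrFun (LinearMap.mem_ker.1 hc) ⟨P, hP⟩
    simpa [Ψ, MvPolynomial.aeval_eq_eval] using this

theorem card_zerosIn_add_card_nonzerosIn (X : Finset Pt) (q : Poly2) :
    (zerosIn X q).card + (nonzerosIn X q).card = X.card :=
  Finset.card_filter_add_card_filter_not _

theorem IsNCorrect.Nn_le_card_nonzerosIn {n e : ℕ} {X : Finset Pt} (hX : IsNCorrect n X)
    {q : Poly2} (hq : q ≠ 0) (hqe : q.totalDegree ≤ e) (he : e ≤ n) :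
    Nn (n - e) ≤ (nonzerosIn X q).card := by
  by_contra! h
  obtain ⟨p, hp0, hpd, hp⟩ := exists_ne_zero_eval_eq_zero _ _ h
  refine mul_ne_zero hp0 hq (hX.2 _ ((totalDegree_mul p q).trans (by omega)) fun P hP => ?_)
  rw [map_mul]
  by_cases hPq : eval P q = 0
  · rw [hPq, mul_zero]
  · rw [hp P (Finset.mem_filter.2 ⟨hP, hPq⟩), zero_mul]

theorem IsNCorrect.isNCorrect_nonzerosIn {n e : ℕ} {X : Finset Pt} (hX : IsNCorrect n X)
    {q : Poly2} (hq : q ≠ 0) (hqe : q.totalDegree ≤ e) (he : e ≤ n)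
    (hcard : (nonzerosIn X q).card = Nn (n - e)) : IsNCorrect (n - e) (nonzerosIn X q) := by
  refine ⟨hcard, fun p hpd hp => ?_⟩
  have h := hX.2 (p * q) ((totalDegree_mul p q).trans (by omega)) fun P hP => by
    rw [map_mul]
    by_cases hPq : eval P q = 0
    · rw [hPq, mul_zero]
    · rw [hp P (Finset.mem_filter.2 ⟨hP, hPq⟩), zero_mul]
  exact (mul_eq_zero.1 h).resolve_right hq

theorem IsNCorrect.isMaximalCurve_iff {n k : ℕ} {X : Finset Pt} (hX : IsNCorrect n X)
    (hk : k ≤ n) {q : Poly2} :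
    IsMaximalCurve n k X q ↔ q.totalDegree = k ∧ (nonzerosIn X q).card = Nn (n - k) := by
  have h₁ := card_zerosIn_add_card_nonzerosIn X q
  have h₂ := d_add_Nn_sub hk
  rw [hX.1] at h₁
  unfold IsMaximalCurve
  constructor <;> rintro ⟨h, h'⟩ <;> exact ⟨h, by omega⟩

/-- Two polynomials vanishing at all nodes but one are proportional. -/
theorem IsNCorrect.eq_C_mul {n : ℕ} {X : Finset Pt} (hX : IsNCorrect n X) {B : Pt}
    {p q : Poly2} (hp : p.totalDegree ≤ n) (hq : q.totalDegree ≤ n)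
    (hpX : ∀ P ∈ X, P ≠ B → eval P p = 0) (hqX : ∀ P ∈ X, P ≠ B → eval P q = 0)
    (hqB : eval B q ≠ 0) : p = MvPolynomial.C (eval B p / eval B q) * q := by
  refine sub_eq_zero.1 (hX.2 _ ((totalDegree_sub _ _).trans (max_le hp ?_)) fun P hP => ?_)
  · refine (totalDegree_mul _ _).trans ?_
    rwa [totalDegree_C, zero_add]
  · by_cases hPB : P = B
    · subst hPB
      simp [hqB]
    · simp [hpX P hP hPB, hqX P hP hPB]

theorem IsNCorrect.exists_isFund {n : ℕ} {X : Finset Pt} (hX : IsNCorrect n X) {B : Pt}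
    (hB : B ∈ X) : ∃ p, IsFund n X B p := by
  obtain ⟨p, hp0, hpd, hp⟩ := exists_ne_zero_eval_eq_zero n (X.erase B) (by
    rw [← hX.1]; exact Finset.card_erase_lt_of_mem hB)
  have hpX : ∀ P ∈ X, P ≠ B → eval P p = 0 := fun P hP hPB =>
    hp P (Finset.mem_erase.2 ⟨hPB, hP⟩)
  have hpB : eval B p ≠ 0 := fun h => hp0 <| hX.2 p hpd fun P hP => by
    by_cases hPB : P = B
    · rw [hPB, h]
    · exact hpX P hP hPB
  refine ⟨MvPolynomial.C (eval B p)⁻¹ * p, ?_, by simp [hpB], fun P hP hPB => by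
    simp [hpX P hP hPB]⟩
  refine (totalDegree_mul _ _).trans ?_
  rwa [totalDegree_C, zero_add]

theorem IsLine.ne_zero {L : Poly2} (hL : IsLine L) : L ≠ 0 := by
  rintro rfl
  simp [IsLine] at hL

theorem IsLine.prime {L : Poly2} (hL : IsLine L) : Prime L := by
  refine (MvPolynomial.irreducible_of_totalDegree_eq_one hL fun x hx => ?_).prime
  obtain ⟨i, hi⟩ := MvPolynomial.ne_zero_iff.1 hL.ne_zero
  refine IsUnit.mk0 x ?_
  rintro rfl
  exact hi (zero_dvd_iff.1 (hx i))

theorem exists_eq_of_totalDegree_le_one {L : Poly2} (hL : L.totalDegree ≤ 1) :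
    ∃ a b c : ℝ, L = MvPolynomial.C a * X 0 + MvPolynomial.C b * X 1 + MvPolynomial.C c := by
  refine ⟨coeff (Finsupp.single 0 1) L, coeff (Finsupp.single 1 1) L, coeff 0 L, ?_⟩
  have h01 : (Finsupp.single 0 1 : Fin 2 →₀ ℕ) ≠ Finsupp.single 1 1 := by
    intro h
    simpa using DFunLike.congr_fun h 0
  have hsub : L.support ⊆ {Finsupp.single 0 1, Finsupp.single 1 1, 0} := by
    intro s hs
    have h := (le_totalDegree hs).trans hL
    rw [Finsupp.sum_fintype _ _ (by simp), Fin.sum_univ_two] at h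
    have : (s 0 = 1 ∧ s 1 = 0) ∨ (s 0 = 0 ∧ s 1 = 1) ∨ (s 0 = 0 ∧ s 1 = 0) := by omega
    simp only [Finset.mem_insert, Finset.mem_singleton]
    refine this.imp ?_ (Or.imp ?_ ?_) <;> rintro ⟨h₀, h₁⟩ <;> ext i <;> fin_cases i <;>
      simp [h₀, h₁]
  conv_lhs => rw [L.as_sum, Finset.sum_subset hsub fun s _ hs => by
    rw [notMem_support_iff.1 hs, monomial_zero]]
  rw [Finset.sum_insert (by simp [h01]), Finset.sum_insert (by simp), Finset.sum_singleton,
    ← add_assoc]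
  simp only [X, C_mul_monomial, mul_one]
  rfl

/-- The points of a line are parametrized by affine functions. -/
theorem IsLine.exists_param {L : Poly2} (hL : IsLine L) {P : Pt} (hP : eval P L = 0) :
    ∃ v : Pt, ∀ M, eval M L = 0 → ∃ t : ℝ, ∀ i, M i = P i + t * v i := by
  obtain ⟨a, b, c, rfl⟩ := exists_eq_of_totalDegree_le_one (le_of_eq hL)
  have hab : a ^ 2 + b ^ 2 ≠ 0 := by
    intro h
    have ha : a = 0 := by nlinarith [sq_nonneg a, sq_nonneg b]
    have hb : b = 0 := by nlinarith [sq_nonneg a, sq_nonneg b]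
    simp [IsLine, ha, hb] at hL
  refine ⟨![b, -a], fun M hM => ⟨(b * (M 0 - P 0) - a * (M 1 - P 1)) / (a ^ 2 + b ^ 2), ?_⟩⟩
  simp only [map_add, map_mul, eval_C, eval_X] at hP hM
  have h : a * (M 0 - P 0) + b * (M 1 - P 1) = 0 := by linarith
  rw [Fin.forall_fin_two]
  constructor
  · simp
    field_simp
    linear_combination a * h
  · simp
    field_simp
    linear_combination b * h

/-- A polynomial of degree at most `e` not vanishing identically on a line has at most
`e` zeros there. -/
theorem IsLine.card_le {L g : Poly2} (hL : IsLine L) {e : ℕ} (hg : g.totalDegree ≤ e) {P : Pt}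
    (hP : eval P L = 0) (hgP : eval P g ≠ 0) (S : Finset Pt)
    (hS : ∀ M ∈ S, eval M L = 0 ∧ eval M g = 0) : S.card ≤ e := by
  obtain ⟨v, hv⟩ := hL.exists_param hP
  let f : Fin 2 → Polynomial ℝ := fun i => Polynomial.C (P i) + Polynomial.X * Polynomial.C (v i)
  let G : Polynomial ℝ := MvPolynomial.aeval f g
  have hG : ∀ t : ℝ, G.eval t = eval (fun i => P i + t * v i) g := by
    intro t
    change Polynomial.eval t (MvPolynomial.aeval f g) = _
    rw [← Polynomial.coe_aeval_eq_eval, ← AlgHom.comp_apply, MvPolynomial.comp_aeval]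
    simp [f, MvPolynomial.aeval_eq_eval, mul_comm t]
  have hG0 : G ≠ 0 := fun h => hgP <| by
    have := hG 0
    simpa [h] using this.symm
  have hdeg : G.natDegree ≤ e := by
    have := MvPolynomial.aeval_natDegree_le g hg f (n := 1) fun i => by
      simp only [f]
      compute_degree
    simpa using this
  choose! t ht using hv
  have hinj : Set.InjOn t (S : Set Pt) := by
    intro M hM M' hM' h
    funext i
    rw [ht M (hS M hM).1, ht M' (hS M' hM').1, h]
  calc S.card = (S.image t).card := (Finset.card_image_of_injOn hinj).symm
    _ ≤ G.roots.toFinset.card := Finset.card_le_card fun r hr => by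
        obtain ⟨M, hM, rfl⟩ := Finset.mem_image.1 hr
        rw [Multiset.mem_toFinset, Polynomial.mem_roots hG0, Polynomial.IsRoot, hG,
          ← (hS M hM).2]
        congr 2
        funext i
        exact (ht M (hS M hM).1 i).symm
    _ ≤ G.natDegree := (Multiset.toFinset_card_le _).trans (Polynomial.card_roots' _)
    _ ≤ e := hdeg

theorem card_nonzerosIn_eq_add (X : Finset Pt) (L q : Poly2) :
    (nonzerosIn X q).card = (nonzerosIn X (L * q)).card +
      (X.filter fun M => eval M L = 0 ∧ eval M q ≠ 0).card := by
  rw [← Finset.card_filter_add_card_filter_not (s := nonzerosIn X q) (fun M => eval M L ≠ 0)]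
  congr 2 <;> ext M <;> simp only [nonzerosIn, Finset.mem_filter, map_mul] <;> grind

section NodesOnLine

variable {X : Finset Pt} {A B C : Pt} {f q g L : Poly2} {c : ℝ} {e : ℕ}

theorem eval_ne_zero_of_nonzerosIn_eq (hf : nonzerosIn X f = {A, B, C}) {M : Pt}
    (hM : M = A ∨ M = B ∨ M = C) : eval M f ≠ 0 := by
  have : M ∈ nonzerosIn X f := by rw [hf]; simpa using hM
  exact (Finset.mem_filter.1 this).2

theorem eval_eq_zero_of_nonzerosIn_eq (hf : nonzerosIn X f = {A, B, C}) {M : Pt} (hM : M ∈ X)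
    (hMA : M ≠ A) (hMB : M ≠ B) (hMC : M ≠ C) : eval M f = 0 := by
  by_contra h
  have : M ∈ nonzerosIn X f := Finset.mem_filter.2 ⟨hM, h⟩
  rw [hf] at this
  simp [hMA, hMB, hMC] at this

theorem card_filter_line_le (hL : IsLineThrough L A C) (hLB : eval B L ≠ 0)
    (hf : nonzerosIn X f = {A, B, C}) (hfq : f = MvPolynomial.C c * (q * g))
    (hg : g.totalDegree ≤ e) :
    (X.filter fun M => eval M L = 0 ∧ eval M q ≠ 0).card ≤ e + 2 := by
  have hfA := eval_ne_zero_of_nonzerosIn_eq hf (.inl rfl)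
  simp only [hfq, map_mul, eval_C, ne_eq, mul_eq_zero, not_or] at hfA
  set S := X.filter fun M => eval M L = 0 ∧ eval M q ≠ 0 with hS
  have h := hL.1.card_le hg hL.2.1 hfA.2.2 (S \ {A, C}) fun M hM => by
    simp only [hS, Finset.mem_sdiff, Finset.mem_filter, Finset.mem_insert, Finset.mem_singleton,
      not_or] at hM
    refine ⟨hM.1.2.1, ?_⟩
    have := eval_eq_zero_of_nonzerosIn_eq hf hM.1.1 hM.2.1
      (by rintro rfl; exact hLB hM.1.2.1) hM.2.2
    simpa [hfq, hfA.1, hM.1.2.2] using this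
  have h₁ := Finset.le_card_sdiff {A, C} S
  have h₂ := Finset.card_le_two (a := A) (b := C)
  omega

theorem coe_filter_line_eq (hL : IsLineThrough L A C) (hLB : eval B L ≠ 0)
    (hf : nonzerosIn X f = {A, B, C}) (hfq : f = MvPolynomial.C c * (q * g))
    (hg : g.totalDegree ≤ e) (hA : A ∈ X) (hC : C ∈ X) (hAC : A ≠ C)
    (hcard : (X.filter fun M => eval M L = 0 ∧ eval M q ≠ 0).card = e + 2) :
    (↑(X.filter fun M => eval M L = 0 ∧ eval M q ≠ 0) : Set Pt) =
      {A, C} ∪ {M : Pt | eval M L = 0 ∧ eval M g = 0} := by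
  have hfA := eval_ne_zero_of_nonzerosIn_eq hf (.inl rfl)
  have hfC := eval_ne_zero_of_nonzerosIn_eq hf (.inr (.inr rfl))
  simp only [hfq, map_mul, eval_C, ne_eq, mul_eq_zero, not_or] at hfA hfC
  set S := X.filter fun M => eval M L = 0 ∧ eval M q ≠ 0 with hS
  have hAS : A ∈ S := Finset.mem_filter.2 ⟨hA, hL.2.1, hfA.2.1⟩
  have hCS : C ∈ S := Finset.mem_filter.2 ⟨hC, hL.2.2, hfC.2.1⟩
  have hzero : ∀ M ∈ S \ {A, C}, eval M L = 0 ∧ eval M g = 0 := fun M hM => by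
    simp only [hS, Finset.mem_sdiff, Finset.mem_filter, Finset.mem_insert, Finset.mem_singleton,
      not_or] at hM
    refine ⟨hM.1.2.1, ?_⟩
    have := eval_eq_zero_of_nonzerosIn_eq hf hM.1.1 hM.2.1
      (by rintro rfl; exact hLB hM.1.2.1) hM.2.2
    simpa [hfq, hfA.1, hM.1.2.2] using this
  ext M
  simp only [Finset.mem_coe, Set.mem_union, Set.mem_insert_iff, Set.mem_singleton_iff,
    Set.mem_ofPred_eq]
  constructor
  · intro hM
    by_cases hMAC : M = A ∨ M = C
    · exact .inl hMAC
    · exact .inr (hzero M (by simpa [hM] using hMAC))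
  · rintro ((rfl | rfl) | hM)
    · exact hAS
    · exact hCS
    · by_contra hMS
      have h := hL.1.card_le hg hL.2.1 hfA.2.2 (insert M (S \ {A, C})) fun P hP => by
        obtain rfl | hP := Finset.mem_insert.1 hP
        · exact hM
        · exact hzero P hP
      rw [Finset.card_insert_of_notMem fun h => hMS (Finset.mem_sdiff.1 h).1,
        Finset.card_sdiff_of_subset (by simp [Finset.insert_subset_iff, hAS, hCS]),
        Finset.card_pair hAC, hcard] at h
      omega

end NodesOnLine

theorem IsNCorrect.eval_ne_zero_of_isLineThrough {n : ℕ} {X : Finset Pt} (hX : IsNCorrect n X)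
    {A B C : Pt} {f L : Poly2} (hn : 1 ≤ n) (hfd : f.totalDegree = n - 1)
    (hf : nonzerosIn X f = {A, B, C}) (hL : IsLineThrough L A C) : eval B L ≠ 0 := by
  intro hLB
  have hf0 : f ≠ 0 := by
    rintro rfl
    exact eval_ne_zero_of_nonzerosIn_eq hf (M := A) (.inl rfl) (map_zero _)
  have h := hX.2 (f * L) ((totalDegree_mul f L).trans (by rw [hfd, hL.1]; omega)) fun M hM => by
    rw [map_mul]
    by_cases hMf : eval M f = 0
    · rw [hMf, zero_mul]
    · have hM' : M ∈ nonzerosIn X f := Finset.mem_filter.2 ⟨hM, hMf⟩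
      rw [hf] at hM'
      simp only [Finset.mem_insert, Finset.mem_singleton] at hM'
      obtain rfl | rfl | rfl := hM'
      · rw [hL.2.1, mul_zero]
      · rw [hLB, mul_zero]
      · rw [hL.2.2, mul_zero]
  exact mul_ne_zero hf0 hL.1.ne_zero h

/-- Theorem 2: with `μ` a maximal curve of degree `k ≤ n` for the
`n`-correct set `X` and `{A i, B, C i}`, `i = 1,…,m` (`m ≥ 2`), distinct special triplets
with common node `B ∈ X \ μ`, `A i ∈ X ∩ μ`, `C i ∈ X`, and `ℓ i := ℓ_{A_i C_i}` :
(1) each `ℓ i` is a component of `μ`, the `m` components are distinct (hence `m ≤ k`),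
`B ∉ ℓ i` and `{A j, C j} ∩ ℓ i = ∅` for `j ≠ i`;
(2) each `μ_{k-i} := μ/(ℓ₁⋯ℓ_i)` is a maximal curve of degree `k-i`;
(3) each `ℬ_{n-k+i} := X \ μ_{k-i}` is `(n-k+i)`-correct and each set
`ℓ̇ i = {M ∈ ℓ_i ∩ X : μ_{k-i}(M) ≠ 0}` consists of `A i`, `C i`, the `n-k` zeros of
`p*_{B,ℬ}` on `ℓ i` (all real and distinct) and the `i-1` intersection points
`D_{ij} = ℓ_i ∩ ℓ_j`, `j < i`;
(4) `ℓ i` is a maximal line of `ℬ_{n-k+s}` for every `s ≥ i`. -/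
theorem several_special_triplets (n k m : ℕ) (X : Finset Pt)
    (hX : IsNCorrect n X) (hkn : k ≤ n) (hm : 2 ≤ m)
    (μ : Poly2) (hμ : IsMaximalCurve n k X μ)
    (A C : Fin m → Pt) (B : Pt)
    (hA : ∀ i, A i ∈ X) (hAμ : ∀ i, eval (A i) μ = 0)
    (hB : B ∈ X) (hBμ : eval B μ ≠ 0) (hC : ∀ i, C i ∈ X)
    (hsp : ∀ i, IsSpecialTriplet n X (A i) B (C i))
    (hdist : ∀ i j, i ≠ j → ({A i, B, C i} : Finset Pt) ≠ {A j, B, C j})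
    (ℓ : Fin m → Poly2) (hℓ : ∀ i, IsLineThrough (ℓ i) (A i) (C i)) :
    ((∏ i, ℓ i) ∣ μ) ∧ m ≤ k ∧
    (∀ i j, i ≠ j → zeroSet (ℓ i) ≠ zeroSet (ℓ j)) ∧
    (∀ i, eval B (ℓ i) ≠ 0) ∧
    (∀ i j, i ≠ j → eval (A j) (ℓ i) ≠ 0 ∧ eval (C j) (ℓ i) ≠ 0) ∧
    (∀ (i : Fin m) (μ' : Poly2),
      μ = (∏ j ∈ Finset.univ.filter fun j => j ≤ i, ℓ j) * μ' →
      IsMaximalCurve n (k - (i.1 + 1)) X μ' ∧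
      IsNCorrect (n - k + i.1 + 1) (nonzerosIn X μ') ∧
      (∀ pB : Poly2, IsFund (n - k) (nonzerosIn X μ) B pB →
        (↑(X.filter fun M => eval M (ℓ i) = 0 ∧ eval M μ' ≠ 0) : Set Pt) =
          {A i, C i} ∪ {M : Pt | eval M (ℓ i) = 0 ∧ eval M pB = 0} ∪
            {M : Pt | eval M (ℓ i) = 0 ∧ ∃ j, j < i ∧ eval M (ℓ j) = 0} ∧
        (X.filter fun M => eval M (ℓ i) = 0 ∧ eval M μ' ≠ 0).card = n - k + i.1 + 2)) ∧
    (∀ (i s : Fin m) (μ'' : Poly2), i ≤ s →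
      μ = (∏ j ∈ Finset.univ.filter fun j => j ≤ s, ℓ j) * μ'' →
      IsMaximalLine (n - k + s.1 + 1) (nonzerosIn X μ'') (ℓ i)) := by
  have h0 : 0 < m := by omega
  have hμ0 : μ ≠ 0 := by
    rintro rfl
    exact hBμ (map_zero _)
  have hn : 1 ≤ n := by
    obtain ⟨hA₀, hB₀, -, hAB, -⟩ := hsp ⟨0, h0⟩
    by_contra! h
    have h₁ := Finset.one_lt_card.2 ⟨_, hA₀, _, hB₀, hAB⟩
    obtain rfl : n = 0 := by omega
    rw [hX.1] at h₁
    simp [Nn] at h₁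
  have hAB : ∀ i, A i ≠ B := fun i => (hsp i).2.2.2.1
  have hAC : ∀ i, A i ≠ C i := fun i => (hsp i).2.2.2.2.1
  have hBC : ∀ i, B ≠ C i := fun i => (hsp i).2.2.2.2.2.1
  choose f hfmax hf using fun i => (hsp i).2.2.2.2.2.2
  have hℓB : ∀ i, eval B (ℓ i) ≠ 0 := fun i =>
    hX.eval_ne_zero_of_isLineThrough hn (hfmax i).1 (hf i) (hℓ i)
  have hfA : ∀ i, eval (A i) (f i) ≠ 0 := fun i => eval_ne_zero_of_nonzerosIn_eq (hf i) (.inl rfl)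
  have hfB : ∀ i, eval B (f i) ≠ 0 := fun i =>
    eval_ne_zero_of_nonzerosIn_eq (hf i) (.inr (.inl rfl))
  have hfC : ∀ i, eval (C i) (f i) ≠ 0 := fun i =>
    eval_ne_zero_of_nonzerosIn_eq (hf i) (.inr (.inr rfl))
  have hfℓdeg : ∀ i, (f i * ℓ i).totalDegree ≤ n := fun i =>
    (totalDegree_mul _ _).trans (by rw [(hfmax i).1, (hℓ i).1]; omega)
  have hfℓX : ∀ i, ∀ P ∈ X, P ≠ B → eval P (f i * ℓ i) = 0 := fun i P hP hPB => by
    rw [map_mul]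
    by_cases hPA : P = A i
    · rw [hPA, (hℓ i).2.1, mul_zero]
    by_cases hPC : P = C i
    · rw [hPC, (hℓ i).2.2, mul_zero]
    rw [eval_eq_zero_of_nonzerosIn_eq (hf i) hP hPA hPB hPC, zero_mul]
  have hfactor : ∀ pB, IsFund (n - k) (nonzerosIn X μ) B pB → ∀ i, ∃ c : ℝ,
      f i * ℓ i = MvPolynomial.C c * (μ * pB) := by
    rintro pB ⟨hd, hpB, hp⟩ i
    refine ⟨_, hX.eq_C_mul (hfℓdeg i) ((totalDegree_mul _ _).trans ?_) (hfℓX i) ?_ ?_⟩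
    · rw [hμ.1]
      omega
    · intro P hP hPB
      rw [map_mul]
      by_cases hPμ : eval P μ = 0
      · rw [hPμ, zero_mul]
      · rw [hp P (Finset.mem_filter.2 ⟨hP, hPμ⟩) hPB, mul_zero]
    · rw [map_mul, hpB, mul_one]
      exact hBμ
  have hcorrect := hX.isNCorrect_nonzerosIn hμ0 hμ.1.le hkn ((hX.isMaximalCurve_iff hkn).1 hμ).2
  obtain ⟨pB₀, hpB₀⟩ := hcorrect.exists_isFund (Finset.mem_filter.2 ⟨hB, hBμ⟩)
  have hdvd : ∀ i, ℓ i ∣ μ := by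
    intro i
    obtain ⟨c, hc⟩ := hfactor pB₀ hpB₀ i
    by_contra hnd
    have h : ℓ i ∣ μ * (MvPolynomial.C c * pB₀) := ⟨f i, by linear_combination -hc⟩
    obtain ⟨r, hr⟩ := ((hℓ i).1.prime.dvd_or_dvd h).resolve_left hnd
    have hfi : f i = μ * r := mul_right_cancel₀ (hℓ i).1.ne_zero (by
      linear_combination hc + μ * hr)
    apply hfA i
    rw [hfi, map_mul, hAμ, zero_mul]
  have hndvd : ∀ i j, i ≠ j → ¬ ℓ i ∣ ℓ j := by
    rintro i j hij ⟨r, hr⟩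
    have h := hX.eq_C_mul (hfℓdeg i) (hfℓdeg j) (hfℓX i) (hfℓX j) (by
      rw [map_mul]
      exact mul_ne_zero (hfB j) (hℓB j))
    generalize eval B (f i * ℓ i) / eval B (f j * ℓ j) = c at h
    have hfi : f i = MvPolynomial.C c * (f j * r) := mul_right_cancel₀ (hℓ i).1.ne_zero (by
      rw [hr] at h
      linear_combination h)
    have hsub : nonzerosIn X (f i) ⊆ nonzerosIn X (f j) := fun P hP => by
      simp only [nonzerosIn, Finset.mem_filter] at hP ⊢
      refine ⟨hP.1, fun h0 => hP.2 ?_⟩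
      rw [hfi]
      simp [h0]
    rw [hf, hf] at hsub
    refine hdist i j hij (Finset.eq_of_subset_of_card_le hsub ?_)
    rw [Finset.card_eq_three.2 ⟨_, _, _, hAB i, hAC i, hBC i, rfl⟩,
      Finset.card_eq_three.2 ⟨_, _, _, hAB j, hAC j, hBC j, rfl⟩]
  have hoff : ∀ i j, i ≠ j → eval (A j) (ℓ i) ≠ 0 ∧ eval (C j) (ℓ i) ≠ 0 := by
    intro i j hij
    have h := hX.eq_C_mul (hfℓdeg j) (hfℓdeg i) (hfℓX j) (hfℓX i) (by
      rw [map_mul]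
      exact mul_ne_zero (hfB i) (hℓB i))
    obtain ⟨r, hr⟩ := ((hℓ i).1.prime.dvd_or_dvd
      (by rw [h, ← mul_assoc]; exact dvd_mul_left _ _ : ℓ i ∣ f j * ℓ j)).resolve_right (hndvd i j hij)
    have hA' := hfA j
    have hC' := hfC j
    rw [hr, map_mul] at hA' hC'
    exact ⟨left_ne_zero_of_mul hA', left_ne_zero_of_mul hC'⟩
  have hprod : (∏ i, ℓ i) ∣ μ := Finset.prod_dvd_of_isRelPrime
    (fun i _ j _ hij => (hℓ i).1.prime.irreducible.isRelPrime_iff_not_dvd.2 (hndvd i j hij))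
    fun i _ => hdvd i
  have hprod0 : ∀ T : Finset (Fin m), ∏ j ∈ T, ℓ j ≠ 0 := fun T =>
    Finset.prod_ne_zero_iff.2 fun j _ => (hℓ j).1.ne_zero
  have hproddeg : ∀ T : Finset (Fin m), (∏ j ∈ T, ℓ j).totalDegree = T.card := by
    intro T
    induction T using Finset.induction_on with
    | empty => simp
    | insert i T hi ih =>
      rw [Finset.prod_insert hi, totalDegree_mul_of_isDomain (hℓ i).1.ne_zero (hprod0 T), ih,
        (hℓ i).1, Finset.card_insert_of_notMem hi, add_comm]
  have hcodeg : ∀ (T : Finset (Fin m)) (q : Poly2), μ = (∏ j ∈ T, ℓ j) * q →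
      q ≠ 0 ∧ q.totalDegree + T.card = k := by
    intro T q hq
    have hq0 : q ≠ 0 := right_ne_zero_of_mul (hq ▸ hμ0)
    refine ⟨hq0, ?_⟩
    rw [← hμ.1, hq, totalDegree_mul_of_isDomain (hprod0 T) hq0, hproddeg, add_comm]
  have hfi : ∀ pB, IsFund (n - k) (nonzerosIn X μ) B pB → ∀ (T : Finset (Fin m)) (i : Fin m)
      (q : Poly2), μ = (∏ j ∈ T, ℓ j) * (ℓ i * q) →
      ∃ c : ℝ, f i = MvPolynomial.C c * (q * ((∏ j ∈ T, ℓ j) * pB)) := by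
    intro pB hpB T i q hq
    obtain ⟨c, hc⟩ := hfactor pB hpB i
    refine ⟨c, mul_right_cancel₀ (hℓ i).1.ne_zero ?_⟩
    rw [hc, hq]
    ring
  have hgdeg : ∀ pB, IsFund (n - k) (nonzerosIn X μ) B pB → ∀ T : Finset (Fin m),
      ((∏ j ∈ T, ℓ j) * pB).totalDegree ≤ n - k + T.card := by
    intro pB hpB T
    refine (totalDegree_mul _ _).trans ?_
    rw [hproddeg, add_comm]
    exact Nat.add_le_add_right hpB.1 _
  have hcard : ∀ (T : Finset (Fin m)) (q : Poly2), μ = (∏ j ∈ T, ℓ j) * q →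
      (nonzerosIn X q).card = Nn (n - k + T.card) := by
    intro T
    induction T using Finset.induction_on with
    | empty =>
      intro q hq
      obtain rfl : μ = q := by simpa using hq
      exact hcorrect.1
    | insert i T hi ih =>
      intro q hq
      obtain ⟨hq0, hqd⟩ := hcodeg _ q hq
      rw [Finset.card_insert_of_notMem hi] at hqd ⊢
      rw [Finset.prod_insert hi] at hq
      have hq' : μ = (∏ j ∈ T, ℓ j) * (ℓ i * q) := by rw [hq]; ring
      obtain ⟨c, hc⟩ := hfi pB₀ hpB₀ T i q hq'
      have h₁ := card_filter_line_le (hℓ i) (hℓB i) (hf i) hc (hgdeg pB₀ hpB₀ T)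
      have h₂ := hX.Nn_le_card_nonzerosIn hq0 le_rfl (by omega)
      have h₃ := card_nonzerosIn_eq_add X (ℓ i) q
      have h₄ := Nn_succ (n - k + T.card)
      rw [ih _ hq'] at h₃
      rw [show n - q.totalDegree = n - k + T.card + 1 by omega] at h₂
      rw [← add_assoc]
      omega
  have hline : ∀ (T : Finset (Fin m)), ∀ i ∈ T, ∀ q : Poly2, μ = (∏ j ∈ T, ℓ j) * q →
      (X.filter fun M => eval M (ℓ i) = 0 ∧ eval M q ≠ 0).card = n - k + T.card + 1 := by
    intro T i hi q hq
    have hq' : μ = (∏ j ∈ T.erase i, ℓ j) * (ℓ i * q) := by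
      rw [hq, ← Finset.mul_prod_erase T ℓ hi]; ring
    have h₁ := card_nonzerosIn_eq_add X (ℓ i) q
    have h₂ := Finset.card_erase_add_one hi
    rw [hcard _ _ hq, hcard _ _ hq', ← h₂, ← add_assoc, Nn_succ] at h₁
    omega
  have hIic : ∀ i : Fin m, (Finset.univ.filter fun j => j ≤ i).card = i.1 + 1 := fun i => by
    rw [Finset.filter_ge_eq_Iic, Fin.card_Iic]
  refine ⟨hprod, ?_, ?_, hℓB, hoff, ?_, ?_⟩
  · obtain ⟨q, hq⟩ := hprod
    have := (hcodeg _ q hq).2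
    rw [Finset.card_univ, Fintype.card_fin] at this
    omega
  · intro i j hij h
    have : A j ∈ zeroSet (ℓ i) := h ▸ (hℓ j).2.1
    exact (hoff i j hij).1 this
  · intro i q hq
    obtain ⟨hq0, hqd⟩ := hcodeg _ q hq
    have hNn := hcard _ q hq
    rw [hIic] at hqd hNn
    have hnk : n - (k - (i.1 + 1)) = n - k + (i.1 + 1) := by omega
    refine ⟨(hX.isMaximalCurve_iff (by omega)).2 ⟨by omega, by rw [hnk, hNn]⟩, ?_, ?_⟩
    · have := hX.isNCorrect_nonzerosIn (e := k - (i.1 + 1)) hq0 (by omega) (by omega)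
        (by rw [hnk, hNn])
      rwa [hnk, ← add_assoc] at this
    · intro pB hpB
      have hmem : i ∈ Finset.univ.filter fun j => j ≤ i := by simp
      have hS := hline _ i hmem q hq
      rw [hIic] at hS
      refine ⟨?_, by omega⟩
      have hq' : μ = (∏ j ∈ (Finset.univ.filter fun j => j ≤ i).erase i, ℓ j) * (ℓ i * q) := by
        rw [hq, ← Finset.mul_prod_erase _ ℓ hmem]; ring
      obtain ⟨c, hc⟩ := hfi pB hpB _ i q hq'
      rw [coe_filter_line_eq (hℓ i) (hℓB i) (hf i) hc (hgdeg pB hpB _) (hA i) (hC i) (hAC i) (by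
        rw [hS, Finset.card_erase_of_mem hmem, hIic]; omega), Set.union_assoc]
      congr 1
      ext M
      simp only [Set.mem_ofPred_eq, Set.mem_union, map_mul, map_prod, mul_eq_zero,
        Finset.prod_eq_zero_iff, Finset.mem_erase, Finset.mem_filter, Finset.mem_univ, true_and,
        lt_iff_le_and_ne]
      grind
  · intro i s q his hq
    refine ⟨(hℓ i).1, ?_⟩
    have := hline _ i (by simpa using his) q hq
    rw [hIic] at this
    rw [zerosIn, nonzerosIn, Finset.filter_filter]
    simp only [and_comm] at this ⊢
    omega
end
end

section
/- Let X be a GC_n set and let ℓ_{A_iB}, 1 ≤ i ≤ m, be distinct 2-node lines of X with common node B, each used by a node C_i, where A_i, B, C_i ∈ X. Then: (1) if m = 2, the two special triplets {A₁,B,C₁} and {A₂,B,C₂} coincide if and only if C₁ = A₂ (equivalently C₂ = A₁), and they are distinct if C₁ ≠ A₂; (2) if m ≥ 3, the special triplets {A_i, B, C_i}, 1 ≤ i ≤ m, are pairwise distinct (in particular the nodes C₁,…,C_m are distinct and different from A₁,…,A_m). -/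
open MvPolynomial Finset
open scoped Classical BigOperators

noncomputable section

/-- Twice the signed area of the triangle `P Q R`. -/
def areaDet (P Q R : Pt) : ℝ := (Q 0 - P 0) * (R 1 - P 1) - (Q 1 - P 1) * (R 0 - P 0)

/-- The polynomial whose value at `R` is `areaDet P Q R`. -/
def lineThrough (P Q : Pt) : Poly2 :=
  C (Q 0 - P 0) * (X 1 - C (P 1)) - C (Q 1 - P 1) * (X 0 - C (P 0))

lemma eval_lineThrough (P Q R : Pt) : eval R (lineThrough P Q) = areaDet P Q R := by
  simp [lineThrough, areaDet]

lemma totalDegree_mul_le_of_le {p q : Poly2} {a b : ℕ} (hp : p.totalDegree ≤ a)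
    (hq : q.totalDegree ≤ b) : (p * q).totalDegree ≤ a + b :=
  (totalDegree_mul p q).trans (Nat.add_le_add hp hq)

lemma totalDegree_C_mul_le {p : Poly2} {a : ℕ} (r : ℝ) (hp : p.totalDegree ≤ a) :
    (C r * p).totalDegree ≤ a := by
  simpa using totalDegree_mul_le_of_le (totalDegree_C (σ := Fin 2) r).le hp

lemma totalDegree_sub_le_of_le {p q : Poly2} {a : ℕ} (hp : p.totalDegree ≤ a)
    (hq : q.totalDegree ≤ a) : (p - q).totalDegree ≤ a :=
  (totalDegree_sub p q).trans (max_le hp hq)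

lemma totalDegree_lineThrough_le (P Q : Pt) : (lineThrough P Q).totalDegree ≤ 1 := by
  refine totalDegree_sub_le_of_le (totalDegree_C_mul_le _ ?_) (totalDegree_C_mul_le _ ?_) <;>
    exact totalDegree_sub_le_of_le (by simp) (by simp)

lemma areaDet_left (P Q : Pt) : areaDet P Q P = 0 := by simp [areaDet]

lemma areaDet_right (P Q : Pt) : areaDet P Q Q = 0 := by simp only [areaDet]; ring

lemma areaDet_swap (P Q R : Pt) : areaDet Q P R = -areaDet P Q R := by simp only [areaDet]; ring

lemma areaDet_rotate (P Q R : Pt) : areaDet Q R P = areaDet P Q R := by simp only [areaDet]; ring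

lemma lineThrough_ne_zero {P Q : Pt} (h : P ≠ Q) : lineThrough P Q ≠ 0 := by
  intro h0
  have h1 := eval_lineThrough P Q ![P 0 - (Q 1 - P 1), P 1 + (Q 0 - P 0)]
  rw [h0] at h1
  simp only [areaDet, map_zero, Matrix.cons_val_zero, Matrix.cons_val_one] at h1
  apply h
  funext i
  have h2 : Q 0 - P 0 = 0 := by nlinarith [sq_nonneg (Q 0 - P 0), sq_nonneg (Q 1 - P 1)]
  have h3 : Q 1 - P 1 = 0 := by nlinarith [sq_nonneg (Q 0 - P 0), sq_nonneg (Q 1 - P 1)]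
  fin_cases i <;> simp <;> linarith

lemma exists_eval_eq_affine {p : Poly2} (hp : p.totalDegree ≤ 1) :
    ∃ a b c : ℝ, ∀ P : Pt, eval P p = a * P 0 + b * P 1 + c := by
  rw [p.as_sum]
  refine Finset.sum_induction _
    (fun q : Poly2 ↦ ∃ a b c : ℝ, ∀ P : Pt, eval P q = a * P 0 + b * P 1 + c) ?_
    ⟨0, 0, 0, by simp⟩ ?_
  · rintro q r ⟨a, b, c, h⟩ ⟨a', b', c', h'⟩
    exact ⟨a + a', b + b', c + c', fun P ↦ by rw [map_add, h, h']; ring⟩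
  · intro v hv
    have h : v 0 + v 1 ≤ 1 := by
      have := (le_totalDegree hv).trans hp
      rwa [Finsupp.sum_fintype _ _ (by simp), Fin.sum_univ_two] at this
    have he (P : Pt) : eval P (monomial v (coeff v p)) = coeff v p * (P 0 ^ v 0 * P 1 ^ v 1) := by
      rw [eval_monomial, Finsupp.prod_fintype _ _ (by simp), Fin.prod_univ_two]
    obtain ⟨h0, h1⟩ | ⟨h0, h1⟩ | ⟨h0, h1⟩ :
        (v 0 = 0 ∧ v 1 = 0) ∨ (v 0 = 1 ∧ v 1 = 0) ∨ (v 0 = 0 ∧ v 1 = 1) := by omega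
    · exact ⟨0, 0, coeff v p, fun P ↦ by rw [he, h0, h1]; ring⟩
    · exact ⟨coeff v p, 0, 0, fun P ↦ by rw [he, h0, h1]; ring⟩
    · exact ⟨0, coeff v p, 0, fun P ↦ by rw [he, h0, h1]; ring⟩

lemma eval_eq_zero_of_collinear {p : Poly2} (hp : p.totalDegree ≤ 1) {P Q R : Pt} (hPQ : P ≠ Q)
    (hP : eval P p = 0) (hQ : eval Q p = 0) (h : areaDet P Q R = 0) : eval R p = 0 := by
  obtain ⟨a, b, c, he⟩ := exists_eval_eq_affine hp
  rw [he] at hP hQ ⊢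
  simp only [areaDet] at h
  by_contra hR
  have h0 : (Q 0 - P 0) * (a * R 0 + b * R 1 + c) = 0 := by
    linear_combination (R 0 - P 0) * (hQ - hP) + b * h + (Q 0 - P 0) * hP
  have h1 : (Q 1 - P 1) * (a * R 0 + b * R 1 + c) = 0 := by
    linear_combination (R 1 - P 1) * (hQ - hP) - a * h + (Q 1 - P 1) * hP
  have h2 := (mul_eq_zero.mp h0).resolve_right hR
  have h3 := (mul_eq_zero.mp h1).resolve_right hR
  apply hPQ
  funext i
  fin_cases i <;> simp <;> linarith

lemma areaDet_eq_zero_of_eval {p : Poly2} (hp : p.totalDegree ≤ 1) (hp0 : p ≠ 0) {P Q R : Pt}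
    (hP : eval P p = 0) (hQ : eval Q p = 0) (hR : eval R p = 0) : areaDet P Q R = 0 := by
  obtain ⟨a, b, c, he⟩ := exists_eval_eq_affine hp
  rw [he] at hP hQ hR
  simp only [areaDet]
  by_contra h
  have ha : a = 0 := by
    refine (mul_eq_zero.mp (?_ : a * _ = 0)).resolve_right h
    linear_combination (R 1 - P 1) * (hQ - hP) - (Q 1 - P 1) * (hR - hP)
  have hb : b = 0 := by
    refine (mul_eq_zero.mp (?_ : b * _ = 0)).resolve_right h
    linear_combination (Q 0 - P 0) * (hR - hP) - (R 0 - P 0) * (hQ - hP)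
  subst ha hb
  refine hp0 (MvPolynomial.funext fun S ↦ ?_)
  rw [he, map_zero]
  linear_combination hP

lemma totalDegree_eq_one_of_eval {p : Poly2} (hp : p.totalDegree ≤ 1) (hp0 : p ≠ 0) {P : Pt}
    (hP : eval P p = 0) : p.totalDegree = 1 := by
  refine le_antisymm hp (Nat.one_le_iff_ne_zero.mpr fun h ↦ hp0 ?_)
  rw [totalDegree_eq_zero_iff_eq_C.mp h, eval_C] at hP
  rw [totalDegree_eq_zero_iff_eq_C.mp h, hP, C_0]

lemma totalDegree_lineThrough {P Q : Pt} (h : P ≠ Q) : (lineThrough P Q).totalDegree = 1 :=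
  totalDegree_eq_one_of_eval (totalDegree_lineThrough_le P Q) (lineThrough_ne_zero h)
    (P := P) (by rw [eval_lineThrough, areaDet_left])

lemma prime_of_totalDegree_eq_one {p : Poly2} (hp : p.totalDegree = 1) : Prime p := by
  have hp0 : p ≠ 0 := by rintro rfl; simp at hp
  refine (irreducible_of_totalDegree_eq_one hp fun x hx ↦ ?_).prime
  obtain ⟨v, hv⟩ := ne_zero_iff.mp hp0
  exact (ne_zero_of_dvd_ne_zero hv (hx v)).isUnit

/-- Two polynomials of degree at most `n` that vanish at all nodes but `A` are proportional. -/
lemma IsNCorrect.proportional {n : ℕ} {X : Finset Pt} (hX : IsNCorrect n X) {A : Pt}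
    {p q : Poly2} (hp : p.totalDegree ≤ n) (hq : q.totalDegree ≤ n)
    (hp0 : ∀ P ∈ X, P ≠ A → eval P p = 0) (hq0 : ∀ P ∈ X, P ≠ A → eval P q = 0) :
    C (eval A q) * p = C (eval A p) * q := by
  refine sub_eq_zero.mp (hX.2 _ (totalDegree_sub_le_of_le (totalDegree_C_mul_le _ hp)
    (totalDegree_C_mul_le _ hq)) fun P hP ↦ ?_)
  by_cases h : P = A
  · subst h; simp [mul_comm]
  · simp [hp0 P hP h, hq0 P hP h]

/-- `f` is a nonzero polynomial of degree less than `n` vanishing at all nodes of `X` but the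
nodes `A`, `B`, `C`. -/
structure IsTripletCurve (n : ℕ) (X : Finset Pt) (A B C : Pt) (f : Poly2) : Prop where
  ne_zero : f ≠ 0
  totalDegree_lt : f.totalDegree + 1 ≤ n
  mem : A ∈ X
  eval_eq_zero : ∀ P ∈ X, P ≠ A → P ≠ B → P ≠ C → eval P f = 0

namespace IsTripletCurve

variable {n : ℕ} {X : Finset Pt} {A B C C' : Pt} {f f' : Poly2}

lemma rotate (hB : B ∈ X) (h : IsTripletCurve n X A B C f) : IsTripletCurve n X B C A f :=
  ⟨h.1, h.2, hB, fun P hP h1 h2 h3 ↦ h.4 P hP h3 h1 h2⟩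

lemma swap (hB : B ∈ X) (h : IsTripletCurve n X A B C f) : IsTripletCurve n X B A C f :=
  ⟨h.1, h.2, hB, fun P hP h1 h2 h3 ↦ h.4 P hP h2 h1 h3⟩

lemma totalDegree_mul_lineThrough_le (h : IsTripletCurve n X A B C f) (P Q : Pt) :
    (f * lineThrough P Q).totalDegree ≤ n :=
  (totalDegree_mul_le_of_le le_rfl (totalDegree_lineThrough_le P Q)).trans h.2

lemma eval_mul_lineThrough (h : IsTripletCurve n X A B C f) :
    ∀ P ∈ X, P ≠ A → eval P (f * lineThrough B C) = 0 := by
  intro P hP hA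
  rw [map_mul, eval_lineThrough]
  by_cases h1 : P = B
  · rw [h1, areaDet_left, mul_zero]
  by_cases h2 : P = C
  · rw [h2, areaDet_right, mul_zero]
  rw [h.4 P hP hA h1 h2, zero_mul]

lemma eval_mul_areaDet_ne_zero (hX : IsNCorrect n X) (hBC : B ≠ C)
    (h : IsTripletCurve n X A B C f) : eval A f * areaDet B C A ≠ 0 := by
  intro h0
  refine mul_ne_zero h.1 (lineThrough_ne_zero hBC)
    (hX.2 _ (h.totalDegree_mul_lineThrough_le B C) fun P hP ↦ ?_)
  by_cases hA : P = A
  · rw [hA, map_mul, eval_lineThrough, h0]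
  · exact h.eval_mul_lineThrough P hP hA

lemma eval_ne_zero (hX : IsNCorrect n X) (hBC : B ≠ C) (h : IsTripletCurve n X A B C f) :
    eval A f ≠ 0 := left_ne_zero_of_mul (h.eval_mul_areaDet_ne_zero hX hBC)

lemma areaDet_ne_zero (hX : IsNCorrect n X) (hBC : B ≠ C) (h : IsTripletCurve n X A B C f) :
    areaDet A B C ≠ 0 := by
  rw [← areaDet_rotate]
  exact right_ne_zero_of_mul (h.eval_mul_areaDet_ne_zero hX hBC)

/-- The curves of triplets with a common node `A` give proportional fundamental polynomials
of `A`. -/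
lemma exists_proportional {B' : Pt} (hX : IsNCorrect n X) (hBC : B ≠ C) (hBC' : B' ≠ C')
    (h : IsTripletCurve n X A B C f) (h' : IsTripletCurve n X A B' C' f') :
    ∃ r : ℝ, r ≠ 0 ∧ f * lineThrough B C = MvPolynomial.C r * (f' * lineThrough B' C') := by
  have hp := hX.proportional (h.totalDegree_mul_lineThrough_le B C)
    (h'.totalDegree_mul_lineThrough_le B' C') h.eval_mul_lineThrough h'.eval_mul_lineThrough
  have h0 := h.eval_mul_areaDet_ne_zero hX hBC
  have h0' := h'.eval_mul_areaDet_ne_zero hX hBC'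
  rw [← eval_lineThrough, ← map_mul] at h0 h0'
  set a := eval A (f * lineThrough B C)
  set b := eval A (f' * lineThrough B' C')
  refine ⟨b⁻¹ * a, mul_ne_zero (inv_ne_zero h0') h0, ?_⟩
  rw [C_mul, mul_assoc, ← hp, ← mul_assoc, ← C_mul, inv_mul_cancel₀ h0', C_1, one_mul]

/-- Two nodes of a triplet determine the third one. -/
lemma unique (hX : IsNCorrect n X) (hB : B ∈ X) (hAC : A ≠ C) (hBC : B ≠ C)
    (hAC' : A ≠ C') (hBC' : B ≠ C') (h : IsTripletCurve n X A B C f)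
    (h' : IsTripletCurve n X A B C' f') : C = C' := by
  obtain ⟨r, hr, hA⟩ := h.exists_proportional hX hBC hBC' h'
  obtain ⟨s, -, hB'⟩ := (h.swap hB).exists_proportional hX hAC hAC' (h'.swap hB)
  have hmul : lineThrough B C * lineThrough A C' * MvPolynomial.C s =
      MvPolynomial.C r * (lineThrough B C' * lineThrough A C) := by
    refine mul_left_cancel₀ (mul_ne_zero h.1 h'.1) ?_
    linear_combination (MvPolynomial.C s * f' * lineThrough A C') * hA
      - (MvPolynomial.C r * f' * lineThrough B C') * hB'
  have hdet := h.areaDet_ne_zero hX hBC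
  have key (t : ℝ) (P Q : Pt) := congrArg (eval (fun i ↦ P i + t * (Q i - P i))) hmul
  simp only [map_mul, eval_C, eval_lineThrough] at key
  have h1 : areaDet B C' C = 0 := by
    have := key (1 / 2) B C
    simp only [areaDet] at this hdet ⊢
    refine (mul_eq_zero.mp ?_).resolve_right (mul_ne_zero hr hdet)
    linear_combination 4 * this
  have h2 : areaDet A C' C = 0 := by
    have := key (1 / 2) A C'
    have hdet' := h'.areaDet_ne_zero hX hBC'
    simp only [areaDet] at this hdet' ⊢
    refine (mul_eq_zero.mp ?_).resolve_right (mul_ne_zero hr hdet')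
    linear_combination 4 * this
  by_contra hne
  have h3 : areaDet C C' A = 0 := by rw [areaDet_swap, areaDet_rotate, h2, neg_zero]
  have h4 : areaDet C C' B = 0 := by rw [areaDet_swap, areaDet_rotate, h1, neg_zero]
  have h5 : areaDet A B C = 0 := areaDet_eq_zero_of_eval (totalDegree_lineThrough_le C C')
    (lineThrough_ne_zero hne) (by rw [eval_lineThrough, h3]) (by rw [eval_lineThrough, h4])
    (by rw [eval_lineThrough, areaDet_left])
  exact hdet h5

end IsTripletCurve

namespace IsTwoNodeLineOf

variable {n : ℕ} {X : Finset Pt} {ℓ : Poly2} {A B C : Pt}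

lemma mem_iff (h : IsTwoNodeLineOf X ℓ A B) (P : Pt) :
    (P ∈ X ∧ eval P ℓ = 0) ↔ (P = A ∨ P = B) := by
  have := congrArg (P ∈ ·) h.2.2
  simpa [zerosIn] using this

lemma left_mem (h : IsTwoNodeLineOf X ℓ A B) : A ∈ X := ((h.mem_iff A).mpr (.inl rfl)).1

lemma right_mem (h : IsTwoNodeLineOf X ℓ A B) : B ∈ X := ((h.mem_iff B).mpr (.inr rfl)).1

/-- Any line through the two nodes of a two-node line contains no further node. -/
lemma eq_or_eq_of_eval (h : IsTwoNodeLineOf X ℓ A B) {g : Poly2} (hg : g.totalDegree ≤ 1)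
    (hg0 : g ≠ 0) (hA : eval A g = 0) (hB : eval B g = 0) {P : Pt} (hP : P ∈ X)
    (hPg : eval P g = 0) : P = A ∨ P = B :=
  (h.mem_iff P).mp ⟨hP, eval_eq_zero_of_collinear h.1.le h.2.1
    ((h.mem_iff A).mpr (.inl rfl)).2 ((h.mem_iff B).mpr (.inr rfl)).2
    (areaDet_eq_zero_of_eval hg hg0 hA hB hPg)⟩

lemma exists_isTripletCurve (hX : IsNCorrect n X) (h : IsTwoNodeLineOf X ℓ A B)
    (hC : Uses n X C ℓ) :
    C ∈ X ∧ C ≠ A ∧ C ≠ B ∧ ∃ f, IsTripletCurve n X A B C f := by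
  obtain ⟨_, ⟨hdeg, hone, hzero⟩, f, rfl⟩ := hC
  have hne : ℓ * f ≠ 0 := fun h0 ↦ by simp [h0] at hone
  rw [map_mul] at hone
  have hℓC : eval C ℓ ≠ 0 := fun h0 ↦ by simp [h0] at hone
  have hnot : ¬(C = A ∨ C = B) := fun hCA ↦ hℓC ((h.mem_iff C).mpr hCA).2
  rw [totalDegree_mul_of_isDomain (left_ne_zero_of_mul hne) (right_ne_zero_of_mul hne),
    h.1, add_comm] at hdeg
  refine ⟨?_, fun h0 ↦ hnot (.inl h0), fun h0 ↦ hnot (.inr h0), f, right_ne_zero_of_mul hne,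
    hdeg, h.left_mem, fun P hP hA hB hPC ↦ ?_⟩
  · by_contra hCX
    refine hne (hX.2 _ ?_ fun P hP ↦ hzero P hP fun hPC ↦ hCX (hPC ▸ hP))
    rwa [totalDegree_mul_of_isDomain (left_ne_zero_of_mul hne) (right_ne_zero_of_mul hne),
      h.1, add_comm]
  · have := hzero P hP hPC
    rw [map_mul] at this
    refine (mul_eq_zero.mp this).resolve_left fun h0 ↦ ?_
    exact ((h.mem_iff P).mp ⟨hP, h0⟩).elim hA hB

end IsTwoNodeLineOf

/-- The curves of two triplets with a single common node, divided by the lines through the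
respective other nodes, leave a common factor. -/
lemma IsTripletCurve.exists_common_factor {n : ℕ} {X : Finset Pt} {B A₁ A₂ A₃ A₄ : Pt}
    {f g : Poly2} (hX : IsNCorrect n X) (hA₁ : A₁ ∈ X) (hA₁₂ : A₁ ≠ A₂) (hA₃₄ : A₃ ≠ A₄)
    (hA₁B : A₁ ≠ B) (hA₂B : A₂ ≠ B) (hA₁₃ : A₁ ≠ A₃) (hA₁₄ : A₁ ≠ A₄)
    (hf : IsTripletCurve n X B A₁ A₂ f) (hg : IsTripletCurve n X B A₃ A₄ g) :
    ∃ (r : ℝ) (h : Poly2), r ≠ 0 ∧ g = h * lineThrough A₁ A₂ ∧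
      f = C r * h * lineThrough A₃ A₄ := by
  obtain ⟨r, hr, hfg⟩ := hf.exists_proportional hX hA₁₂ hA₃₄ hg
  have hL0 := lineThrough_ne_zero hA₁₂
  have hdvd : lineThrough A₁ A₂ ∣ C r * (g * lineThrough A₃ A₄) := ⟨f, by rw [← hfg, mul_comm]⟩
  have hCr : IsUnit (C r : Poly2) := hr.isUnit.map C
  rw [hCr.dvd_mul_left] at hdvd
  rcases (prime_of_totalDegree_eq_one (totalDegree_lineThrough hA₁₂)).dvd_or_dvd hdvd with
    ⟨h, hh⟩ | ⟨k, hk⟩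
  · refine ⟨r, h, hr, by rw [hh, mul_comm], mul_right_cancel₀ hL0 ?_⟩
    rw [hfg, hh]
    ring
  · exfalso
    have hfk : f = C r * g * k := mul_right_cancel₀ hL0 (by rw [hfg, hk]; ring)
    refine (hf.rotate hA₁).eval_ne_zero hX hA₂B ?_
    rw [hfk, map_mul, map_mul, hg.4 A₁ hA₁ hA₁B hA₁₃ hA₁₄, mul_zero, zero_mul]

/-- There is a conic through five points `B`, `A₁`, `A₂`, `A₃`, `A₄`. -/
lemma exists_conic {B A₁ A₂ A₃ A₄ : Pt} (h₁₂B : areaDet A₁ A₂ B ≠ 0) (h₃₄B : areaDet A₃ A₄ B ≠ 0)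
    (h₁₂₃ : areaDet A₁ A₂ A₃ ≠ 0) (h₁₂₄ : areaDet A₁ A₂ A₄ ≠ 0) :
    ∃ q : Poly2, q ≠ 0 ∧ q.totalDegree ≤ 2 ∧ eval B q = 0 ∧ eval A₁ q = 0 ∧ eval A₂ q = 0 ∧
      eval A₃ q = 0 ∧ eval A₄ q = 0 := by
  let v := lineThrough A₁ A₂ * lineThrough A₃ A₄
  let u := lineThrough A₁ A₃ * lineThrough A₂ A₄
  refine ⟨C (eval B u) * v - C (eval B v) * u, fun h0 ↦ ?_, ?_, ?_, ?_, ?_, ?_, ?_⟩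
  · have h1 := congrArg (eval (fun i ↦ A₁ i + 1 / 2 * (A₂ i - A₁ i))) h0
    simp only [v, u, map_sub, map_mul, eval_C, eval_lineThrough, map_zero] at h1
    refine mul_ne_zero (mul_ne_zero h₁₂B h₃₄B) (mul_ne_zero h₁₂₃ h₁₂₄) ?_
    generalize areaDet A₁ A₂ B = b at h1 ⊢
    generalize areaDet A₃ A₄ B = b' at h1 ⊢
    generalize areaDet A₁ A₃ B = c at h1 ⊢
    generalize areaDet A₂ A₄ B = c' at h1 ⊢
    simp only [areaDet] at h1 ⊢
    linear_combination 4 * h1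
  · exact totalDegree_sub_le_of_le
      (totalDegree_C_mul_le _ (totalDegree_mul_le_of_le (totalDegree_lineThrough_le _ _)
        (totalDegree_lineThrough_le _ _)))
      (totalDegree_C_mul_le _ (totalDegree_mul_le_of_le (totalDegree_lineThrough_le _ _)
        (totalDegree_lineThrough_le _ _)))
  · simp [mul_comm]
  all_goals simp [v, u, eval_lineThrough, areaDet_left, areaDet_right]

/-- In a `GC` set, two triplets cannot have exactly one common node `B` if the lines joining `B`
with the other nodes of the first triplet are two-node lines. -/
lemma IsGC.false_of_triplets {n : ℕ} {X : Finset Pt} {B A₁ A₂ A₃ A₄ : Pt} {f g ℓ₁ ℓ₂ : Poly2}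
    (hGC : IsGC n X) (hℓ₁ : IsTwoNodeLineOf X ℓ₁ A₁ B) (hℓ₂ : IsTwoNodeLineOf X ℓ₂ A₂ B)
    (hA₃ : A₃ ∈ X) (hA₄ : A₄ ∈ X) (hA₁₂ : A₁ ≠ A₂) (hA₃₄ : A₃ ≠ A₄)
    (hA₁₃ : A₁ ≠ A₃) (hA₁₄ : A₁ ≠ A₄) (hA₂₃ : A₂ ≠ A₃) (hA₂₄ : A₂ ≠ A₄)
    (hA₃B : A₃ ≠ B) (hA₄B : A₄ ≠ B)
    (hf : IsTripletCurve n X B A₁ A₂ f) (hg : IsTripletCurve n X B A₃ A₄ g) : False := by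
  obtain ⟨hX, hprod⟩ := hGC
  have hA₁ := hℓ₁.left_mem
  have hA₂ := hℓ₂.left_mem
  have hA₁B := hℓ₁.2.1
  have hA₂B := hℓ₂.2.1
  obtain ⟨r, h, hr, rfl, rfl⟩ :=
    hf.exists_common_factor hX hA₁ hA₁₂ hA₃₄ hA₁B hA₂B hA₁₃ hA₁₄ hg
  have hgB := hg.eval_ne_zero hX hA₃₄
  have hgA₃ := (hg.rotate hA₃).eval_ne_zero hX hA₄B
  have hgA₄ := ((hg.rotate hA₃).rotate hA₄).eval_ne_zero hX hA₃B.symm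
  have hh0 : h ≠ 0 := left_ne_zero_of_mul hg.1
  have h₃₄B : areaDet A₃ A₄ B ≠ 0 := by
    rw [areaDet_rotate]
    exact hg.areaDet_ne_zero hX hA₃₄
  rw [map_mul, eval_lineThrough] at hgB hgA₃ hgA₄
  obtain ⟨q, hq0, hqdeg, hqB, hqA₁, hqA₂, hqA₃, hqA₄⟩ := exists_conic
    (right_ne_zero_of_mul hgB) h₃₄B (right_ne_zero_of_mul hgA₃) (right_ne_zero_of_mul hgA₄)
  have hhdeg : h.totalDegree + 2 ≤ n := by
    have := hg.2
    rwa [totalDegree_mul_of_isDomain hh0 (lineThrough_ne_zero hA₁₂),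
      totalDegree_lineThrough hA₁₂] at this
  have hhqdeg : (h * q).totalDegree ≤ n := (totalDegree_mul_le_of_le le_rfl hqdeg).trans hhdeg
  have hlines : ∀ P ∈ X, eval P (h * q) ≠ 0 →
      eval P (lineThrough A₁ A₂) = 0 ∧ eval P (lineThrough A₃ A₄) = 0 := by
    intro P hP hne
    rw [map_mul] at hne
    have hPq := right_ne_zero_of_mul hne
    have hPne : ∀ S, eval S q = 0 → P ≠ S := fun S hS h0 ↦ hPq (h0 ▸ hS)
    have hfP := hf.4 P hP (hPne _ hqB) (hPne _ hqA₁) (hPne _ hqA₂)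
    have hgP := hg.4 P hP (hPne _ hqB) (hPne _ hqA₃) (hPne _ hqA₄)
    simpa [left_ne_zero_of_mul hne, hr] using And.intro hgP hfP
  obtain ⟨P, hP, hPne⟩ : ∃ P ∈ X, eval P (h * q) ≠ 0 := by
    by_contra! hall
    exact mul_ne_zero hh0 hq0 (hX.2 _ hhqdeg hall)
  have hothers : ∀ S ∈ X, S ≠ P → eval S (h * q) = 0 := by
    intro S hS hSP
    by_contra hSne
    refine right_ne_zero_of_mul hgA₃ ?_
    rw [← eval_lineThrough]
    refine eval_eq_zero_of_collinear (totalDegree_lineThrough_le _ _) hSP (hlines S hS hSne).1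
      (hlines P hP hPne).1 (areaDet_eq_zero_of_eval (totalDegree_lineThrough_le A₃ A₄)
        (lineThrough_ne_zero hA₃₄) (hlines S hS hSne).2 (hlines P hP hPne).2 ?_)
    rw [eval_lineThrough, areaDet_left]
  obtain ⟨p, ⟨hpdeg, hpP, hpX⟩, g, hgdeg, hpg⟩ := hprod P hP
  have hprop := hX.proportional hhqdeg hpdeg hothers hpX
  rw [hpP, C_1, one_mul] at hprop
  rw [map_mul] at hPne
  have hBP : B ≠ P := fun h0 ↦ right_ne_zero_of_mul hPne (h0 ▸ hqB)
  obtain ⟨i, -, hi⟩ : ∃ i ∈ Finset.univ, eval B (g i) = 0 := by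
    rw [← Finset.prod_eq_zero_iff, ← map_prod, ← hpg]
    exact hpX B hℓ₁.right_mem hBP
  have hgi := prime_of_totalDegree_eq_one (hgdeg i)
  have hdvd : g i ∣ h * q := by
    rw [hprop, hpg]
    exact (Finset.dvd_prod_of_mem g (Finset.mem_univ i)).mul_left _
  obtain ⟨k, rfl⟩ : g i ∣ q := (hgi.dvd_or_dvd hdvd).resolve_left fun hd ↦
    left_ne_zero_of_mul hgB (zero_dvd_iff.mp (hi ▸ map_dvd (eval B) hd))
  have hkdeg : k.totalDegree ≤ 1 := by
    rw [totalDegree_mul_of_isDomain hgi.ne_zero (right_ne_zero_of_mul hq0), hgdeg i] at hqdeg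
    omega
  rw [map_mul] at hPne hqA₁ hqA₂ hqA₃ hqA₄
  have hkP : eval P k ≠ 0 := right_ne_zero_of_mul (right_ne_zero_of_mul hPne)
  obtain ⟨hP₁₂, hP₃₄⟩ := hlines P hP (by simpa using hPne)
  rw [eval_lineThrough] at hP₁₂ hP₃₄
  have hline {S T : Pt} (hST : S ≠ T) (hdet : areaDet S T P = 0)
      (hS : eval S (g i) * eval S k = 0) (hT : eval T (g i) * eval T k = 0) :
      eval S (g i) = 0 ∨ eval T (g i) = 0 := by
    by_contra! hno
    exact hkP (eval_eq_zero_of_collinear hkdeg hST ((mul_eq_zero.mp hS).resolve_left hno.1)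
      ((mul_eq_zero.mp hT).resolve_left hno.2) hdet)
  obtain ⟨T, hT, hTB, hT₁, hT₂, hTg⟩ :
      ∃ T ∈ X, T ≠ B ∧ T ≠ A₁ ∧ T ≠ A₂ ∧ eval T (g i) = 0 :=
    (hline hA₃₄ hP₃₄ hqA₃ hqA₄).elim
      (fun h0 ↦ ⟨A₃, hA₃, hA₃B, hA₁₃.symm, hA₂₃.symm, h0⟩)
      (fun h0 ↦ ⟨A₄, hA₄, hA₄B, hA₁₄.symm, hA₂₄.symm, h0⟩)
  rcases hline hA₁₂ hP₁₂ hqA₁ hqA₂ with h0 | h0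
  · exact (hℓ₁.eq_or_eq_of_eval (hgdeg i).le hgi.ne_zero h0 hi hT hTg).elim hT₁ hTB
  · exact (hℓ₂.eq_or_eq_of_eval (hgdeg i).le hgi.ne_zero h0 hi hT hTg).elim hT₂ hTB

/-- If the node `A₂` uses a two-node line `A₁B`, then only the node `A₁` can use a two-node
line `A₂B`. -/
lemma IsNCorrect.eq_of_uses {n : ℕ} {X : Finset Pt} (hX : IsNCorrect n X) {A₁ A₂ B C : Pt}
    {ℓ₁ ℓ₂ : Poly2} (hℓ₁ : IsTwoNodeLineOf X ℓ₁ A₁ B) (hℓ₂ : IsTwoNodeLineOf X ℓ₂ A₂ B)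
    (h₁ : Uses n X A₂ ℓ₁) (h₂ : Uses n X C ℓ₂) : C = A₁ := by
  obtain ⟨hA₂, hA₂₁, hA₂B, f, hf⟩ := hℓ₁.exists_isTripletCurve hX h₁
  obtain ⟨hC, hCA₂, hCB, g, hg⟩ := hℓ₂.exists_isTripletCurve hX h₂
  exact hg.unique hX hℓ₁.right_mem hCA₂.symm hCB.symm hA₂₁ hℓ₁.2.1.symm
    ((hf.rotate hℓ₁.right_mem).swap hA₂)

/-- let `X` be a `GC_n` set and `ℓ_{A_i B}` distinct `2`-node lines with
common node `B`, each used by a node `C i`.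
(1) If `m = 2`, the two special triplets `{A₁,B,C₁}`, `{A₂,B,C₂}` coincide iff `C₁ = A₂`
(equivalently `C₂ = A₁`).
(2) If `m ≥ 3`, the special triplets `{A i, B, C i}` are pairwise distinct; in particular
the `C i` are distinct and different from the `A j`. -/
theorem distinct_triplets_from_two_node_lines (n : ℕ) (X : Finset Pt) (hGC : IsGC n X) :
    (∀ (A₁ A₂ B C₁ C₂ : Pt) (ℓ₁ ℓ₂ : Poly2), A₁ ≠ A₂ →
      IsTwoNodeLineOf X ℓ₁ A₁ B → IsTwoNodeLineOf X ℓ₂ A₂ B →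
      Uses n X C₁ ℓ₁ → Uses n X C₂ ℓ₂ →
      ((({A₁, B, C₁} : Finset Pt) = {A₂, B, C₂}) ↔ C₁ = A₂) ∧ (C₁ = A₂ ↔ C₂ = A₁)) ∧
    (∀ m : ℕ, 3 ≤ m → ∀ (A C : Fin m → Pt) (B : Pt) (ℓ : Fin m → Poly2),
      (∀ i j, i ≠ j → A i ≠ A j) →
      (∀ i, IsTwoNodeLineOf X (ℓ i) (A i) B) →
      (∀ i, Uses n X (C i) (ℓ i)) →
      (∀ i j, i ≠ j → ({A i, B, C i} : Finset Pt) ≠ {A j, B, C j}) ∧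
      (∀ i j, i ≠ j → C i ≠ C j) ∧
      (∀ i j, C i ≠ A j)) := by
  have hX := hGC.1
  refine ⟨fun A₁ A₂ B C₁ C₂ ℓ₁ ℓ₂ hA hℓ₁ hℓ₂ hC₁ hC₂ ↦ ?_, fun m hm A C B ℓ hA hℓ hC ↦ ?_⟩
  · have hiff : C₁ = A₂ ↔ C₂ = A₁ :=
      ⟨fun h ↦ hX.eq_of_uses hℓ₁ hℓ₂ (h ▸ hC₁) hC₂, fun h ↦ hX.eq_of_uses hℓ₂ hℓ₁ (h ▸ hC₂) hC₁⟩
    refine ⟨⟨fun h ↦ ?_, fun h ↦ ?_⟩, hiff⟩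
    · have hmem : A₂ ∈ ({A₁, B, C₁} : Finset Pt) := h ▸ Finset.mem_insert_self A₂ _
      simpa [hA.symm, hℓ₂.2.1, eq_comm] using hmem
    · rw [h, hiff.mp h]
      ext P
      simp only [Finset.mem_insert, Finset.mem_singleton]
      tauto
  · have hCX i := (hℓ i).exists_isTripletCurve hX (hC i)
    have hCA : ∀ i j, C i ≠ A j := by
      intro i j hij
      obtain rfl | hne := eq_or_ne i j
      · exact (hCX i).2.1 hij
      have hji := hX.eq_of_uses (hℓ i) (hℓ j) (hij ▸ hC i) (hC j)
      obtain ⟨k, hki, hkj⟩ : ∃ k : Fin m, k ≠ i ∧ k ≠ j := by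
        have hcard : ({i, j} : Finset (Fin m)).card < (Finset.univ : Finset (Fin m)).card := by
          rw [Finset.card_univ, Fintype.card_fin]
          exact Finset.card_le_two.trans_lt hm
        obtain ⟨k, -, hk⟩ := Finset.exists_mem_notMem_of_card_lt_card hcard
        exact ⟨k, by simpa using hk⟩
      have hBX := (hℓ i).right_mem
      obtain ⟨-, -, -, f, hf⟩ := hCX i
      obtain ⟨hCk, hCAk, hCBk, g, hg⟩ := hCX k
      rw [hij] at hf
      have hCki : C k ≠ A i := fun h0 ↦ hA j k hkj.symm
        (hij.symm.trans (hX.eq_of_uses (hℓ k) (hℓ i) (h0 ▸ hC k) (hC i)))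
      have hCkj : C k ≠ A j := fun h0 ↦ hA i k hki.symm
        (hji.symm.trans (hX.eq_of_uses (hℓ k) (hℓ j) (h0 ▸ hC k) (hC j)))
      exact hGC.false_of_triplets (hℓ i) (hℓ j) (hℓ k).left_mem hCk (hA i j hne) hCAk.symm
        (hA i k hki.symm) hCki.symm (hA j k hkj.symm) hCkj.symm (hℓ k).2.1 hCBk
        (hf.swap hBX) (hg.swap hBX)
    refine ⟨fun i j hij h ↦ ?_, fun i j hij h ↦ ?_, hCA⟩
    · have hmem : A j ∈ ({A i, B, C i} : Finset Pt) := h ▸ Finset.mem_insert_self (A j) _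
      simp [hA j i hij.symm, (hℓ j).2.1, (hCA i j).symm] at hmem
    · obtain ⟨hCi, hCAi, hCBi, f, hf⟩ := hCX i
      obtain ⟨-, hCAj, hCBj, g, hg⟩ := hCX j
      rw [← h] at hg hCAj
      have hBX := (hℓ i).right_mem
      exact hA i j hij ((hf.rotate hBX).unique hX hCi (hℓ i).2.1.symm hCAi
        (hℓ j).2.1.symm hCAj (hg.rotate hBX))
end
end
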